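/- arXiv:2601.10475 — 3 statements merged into one kernel-verified Lean document; each statement's English description precedes it below -/
import Mathlib

section
/- Let n be a nonempty finite index type, let G be an n×n complex matrix, and let σ be an n×n real symmetric matrix, with σ_ℂ denoting its entrywise coercion to a complex matrix. Assume the matrix I − G·σ_ℂ is invertible and set H = (I − G·σ_ℂ)⁻¹·G. Then H + Hᴴ is positive semidefinite if and only if G + Gᴴ − 2·G·σ_ℂ·Gᴴ is positive semidefinite. -/
open Matrix ComplexOrder

/-- Theorem 1, part 1 (MIMO positive-damping condition for output-feedback
passivization `H = (I − Gσ)⁻¹ G`). -/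
theorem mimo_pd_condition {n : Type*} [Fintype n] [Nonempty n] [DecidableEq n]
    (G : Matrix n n ℂ) (σ : Matrix n n ℝ) (hσ : σ.IsSymm)
    (σc : Matrix n n ℂ) (hσc : σc = σ.map Complex.ofReal)
    (hinv : IsUnit (1 - G * σc))
    (H : Matrix n n ℂ) (hH : H = (1 - G * σc)⁻¹ * G) :
    (H + Hᴴ).PosSemidef ↔ (G + Gᴴ - (2 : ℂ) • (G * σc * Gᴴ)).PosSemidef := by
  have hσH : σcᴴ = σc := by
    subst hσc
    ext i j
    simp [hσ.apply i j]
  have hAH : (1 - G * σc) * H = G := by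
    rw [hH, mul_nonsing_inv_cancel_left _ _ ((isUnit_iff_isUnit_det _).mp hinv)]
  have hHA : Hᴴ * (1 - G * σc)ᴴ = Gᴴ := by
    rw [← conjTranspose_mul, hAH]
  have key : (1 - G * σc) * (H + Hᴴ) * star (1 - G * σc) =
      G + Gᴴ - (2 : ℂ) • (G * σc * Gᴴ) := by
    rw [star_eq_conjTranspose, mul_add, add_mul, hAH, mul_assoc, hHA, conjTranspose_sub,
      conjTranspose_mul, conjTranspose_one, hσH, two_smul]
    noncomm_ring
  rw [← key, hinv.posSemidef_star_right_conjugate_iff]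
end

section
/- Let n be a nonempty finite index type, let G be an n×n complex matrix, and let σ be an n×n real symmetric positive definite matrix, with σ_ℂ its entrywise coercion to a complex matrix. Then G + Gᴴ − 2·G·σ_ℂ·Gᴴ is positive semidefinite if and only if the 2n×2n block matrix [[G + Gᴴ, G],[Gᴴ, (2σ_ℂ)⁻¹]] is positive semidefinite. -/
open Matrix ComplexOrder

open scoped MatrixOrder in
/-- The entrywise complexification of a real positive definite matrix is positive definite. -/
theorem Matrix.PosDef.map_complexOfReal {n : Type*} [Fintype n] [DecidableEq n]
    {A : Matrix n n ℝ} (hA : A.PosDef) : (A.map Complex.ofReal).PosDef := by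
  have hsemi : (A.map Complex.ofReal).PosSemidef := by
    obtain ⟨B, rfl⟩ := CStarAlgebra.nonneg_iff_eq_star_mul_self.mp hA.posSemidef.nonneg
    have hmap : (star B * B).map Complex.ofReal =
        (B.map Complex.ofReal)ᴴ * B.map Complex.ofReal := by
      ext i j
      simp [Matrix.mul_apply, star_eq_conjTranspose]
    rw [hmap]
    exact posSemidef_conjTranspose_mul_self _
  exact hsemi.posDef_iff_isUnit.mpr (hA.isUnit.map Complex.ofRealHom.mapMatrix)

/-- Corollary 1 (LMI-based MIMO positive-damping condition, via the Schur
complement). -/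
theorem mimo_pd_lmi {n : Type*} [Fintype n] [Nonempty n] [DecidableEq n]
    (G : Matrix n n ℂ) (σ : Matrix n n ℝ) (hσ : σ.PosDef)
    (σc : Matrix n n ℂ) (hσc : σc = σ.map Complex.ofReal) :
    (G + Gᴴ - (2 : ℂ) • (G * σc * Gᴴ)).PosSemidef ↔
      (Matrix.fromBlocks (G + Gᴴ) G Gᴴ (((2 : ℂ) • σc)⁻¹)).PosSemidef := by
  have hD : ((2 : ℂ) • σc).PosDef := hσc ▸ hσ.map_complexOfReal.smul two_pos
  let := hD.inv.isUnit.invertible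
  have h := hD.inv.fromBlocks₂₂ (G + Gᴴ) G
  rw [Matrix.nonsing_inv_nonsing_inv _ ((Matrix.isUnit_iff_isUnit_det _).mp hD.isUnit)] at h
  simpa using h.symm
end

section
/- Let n be a nonempty finite index type, let G be an n×n complex matrix, and let σ be an n×n real symmetric matrix with smallest eigenvalue λ_min(σ), with σ_ℂ its entrywise coercion to a complex matrix. If G + Gᴴ − 2·σ_ℂ is positive semidefinite, then for every complex vector x with xᴴx ≠ 0, the Rayleigh quotient ρ_G(x) = (xᴴGx)/(xᴴx) satisfies Re(ρ_G(x)) ≥ λ_min(σ). -/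
open Matrix ComplexOrder

/-- A real symmetric matrix minus its smallest eigenvalue is positive semidefinite. -/
lemma Matrix.IsHermitian.posSemidef_sub_iInf_eigenvalues {n : Type*} [Fintype n] [DecidableEq n]
    {A : Matrix n n ℝ} (hA : A.IsHermitian) :
    (A - algebraMap ℝ (Matrix n n ℝ) (⨅ i, hA.eigenvalues i)).PosSemidef := by
  set c := ⨅ i, hA.eigenvalues i
  have hB : (A - algebraMap ℝ (Matrix n n ℝ) c).IsHermitian :=
    hA.sub (by rw [algebraMap_eq_diagonal]; exact isHermitian_diagonal _)
  rw [hB.posSemidef_iff_eigenvalues_nonneg]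
  intro i
  have h := hB.eigenvalues_mem_spectrum_real i
  rw [← spectrum.sub_singleton_eq, hA.spectrum_real_eq_range_eigenvalues] at h
  obtain ⟨_, ⟨j, rfl⟩, _, rfl, h⟩ := h
  have := ciInf_le (Set.finite_range hA.eigenvalues).bddBelow j
  simp only [Pi.zero_apply]
  linarith

open scoped MatrixOrder in
/-- Coercing a real positive semidefinite matrix to `ℂ` keeps it positive semidefinite. -/
lemma Matrix.PosSemidef.map_ofReal {n : Type*} [Fintype n] {A : Matrix n n ℝ}
    (hA : A.PosSemidef) : (A.map Complex.ofReal).PosSemidef := by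
  classical
  obtain ⟨B, rfl⟩ := CStarAlgebra.nonneg_iff_eq_star_mul_self.mp hA.nonneg
  rw [star_eq_conjTranspose]
  have : (Bᴴ * B).map Complex.ofReal = (B.map Complex.ofReal)ᴴ * B.map Complex.ofReal := by
    ext i j
    simp [mul_apply]
  rw [this]
  exact posSemidef_conjTranspose_mul_self _

/-- Estimated input-feedforward positive-damping region for the MIMO
input-feedforward passivization `H = G − σ`: if `G + Gᴴ − 2σ ⪰ 0` then every
Rayleigh quotient of `G` has real part at least `λ_min(σ)`. -/
theorem mimo_if_pd_rayleigh {n : Type*} [Fintype n] [Nonempty n] [DecidableEq n]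
    (G : Matrix n n ℂ) (σ : Matrix n n ℝ) (hσ : σ.IsHermitian)
    (lmin : ℝ) (hlmin : lmin = ⨅ i, hσ.eigenvalues i)
    (hpsd : (G + Gᴴ - (2 : ℂ) • σ.map Complex.ofReal).PosSemidef) :
    ∀ x : n → ℂ, star x ⬝ᵥ x ≠ 0 →
      lmin ≤ ((star x ⬝ᵥ G.mulVec x) / (star x ⬝ᵥ x)).re := by
  intro x hx
  have hS := hσ.posSemidef_sub_iInf_eigenvalues.map_ofReal.re_dotProduct_nonneg x
  have hmap : (σ - algebraMap ℝ (Matrix n n ℝ) lmin).map Complex.ofReal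
      = σ.map Complex.ofReal - (lmin : ℂ) • 1 := by
    ext i j
    by_cases hij : i = j <;> simp [algebraMap_matrix_apply, hij]
  rw [← hlmin, hmap] at hS
  have hG := hpsd.re_dotProduct_nonneg x
  have hadj : star x ⬝ᵥ (Gᴴ *ᵥ x) = star (star x ⬝ᵥ (G *ᵥ x)) := by
    rw [star_dotProduct, star_mulVec, conjTranspose_conjTranspose, ← dotProduct_mulVec]
  obtain ⟨hre, him⟩ := Complex.nonneg_iff.mp (dotProduct_star_self_nonneg x)
  set d := star x ⬝ᵥ x
  have hd : d = (d.re : ℂ) := Complex.ext rfl him.symm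
  have hpos : 0 < d.re := hre.lt_of_ne fun h => hx (by rw [hd, ← h, Complex.ofReal_zero])
  simp only [sub_mulVec, add_mulVec, smul_mulVec, one_mulVec, dotProduct_sub, dotProduct_add,
    dotProduct_smul, hadj] at hS hG
  simp [d, ← him] at hS hG
  rw [hd, Complex.div_ofReal_re, le_div_iff₀ hpos]
  linarith
end
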